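/- Let G be a caterpillar, i.e., a finite tree such that deleting all leaves (vertices of degree at most 1) yields a path (the backbone). Then G admits a unit disk intersection representation — a map d : V(G) → ℝ² such that for all distinct vertices u, v, the vertices u and v are adjacent in G if and only if dist(d(u), d(v)) ≤ 2 — if and only if every vertex of G has degree at most 5 and no two adjacent vertices of G both have degree 5. -/

import Mathlib

/-- A graph is a path graph if its vertices can be enumerated `0, 1, …, n-1` such that
two vertices are adjacent iff they are consecutive in the enumeration
(this includes the empty and one-vertex cases). -/
def IsPathGraph {W : Type*} (H : SimpleGraph W) : Prop :=
  ∃ (n : ℕ) (e : W ≃ Fin n),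
    ∀ a b : W, H.Adj a b ↔ ((e a : ℕ) + 1 = (e b : ℕ) ∨ (e b : ℕ) + 1 = (e a : ℕ))

/-- A caterpillar is a finite tree such that deleting all leaves (vertices of degree at
most 1) yields a path, i.e. the subgraph induced on the vertices of degree at least 2
is a path graph. -/
def IsCaterpillar {V : Type*} [Fintype V] (G : SimpleGraph V) [DecidableRel G.Adj] : Prop :=
  G.IsTree ∧ IsPathGraph (G.induce {v : V | 2 ≤ G.degree v})

/-- A unit disk intersection representation (UDR) of a simple graph `G`:
distinct vertices are adjacent iff their disk centers are at distance at most 2. -/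
def IsUDR {V : Type*} (G : SimpleGraph V) (d : V → EuclideanSpace ℝ (Fin 2)) : Prop :=
  ∀ u v : V, u ≠ v → (G.Adj u v ↔ dist (d u) (d v) ≤ 2)

open InnerProductGeometry

theorem cos_angle_eq_div {p q : ℂ} (hp : p ≠ 0) (hq : q ≠ 0) :
    Real.cos (angle p q) = (‖p‖ ^ 2 + ‖q‖ ^ 2 - ‖p - q‖ ^ 2) / (2 * ‖p‖ * ‖q‖) := by
  have h := norm_sub_sq_eq_norm_sq_add_norm_sq_sub_two_mul_norm_mul_norm_mul_cos_angle p q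
  have hp' := norm_pos_iff.2 hp
  have hq' := norm_pos_iff.2 hq
  field_simp
  nlinarith

theorem angle_eq_arccos_div {p q : ℂ} (hp : p ≠ 0) (hq : q ≠ 0) :
    angle p q = Real.arccos ((‖p‖ ^ 2 + ‖q‖ ^ 2 - ‖p - q‖ ^ 2) / (2 * ‖p‖ * ‖q‖)) := by
  rw [← cos_angle_eq_div hp hq, Real.arccos_cos (angle_nonneg _ _) (angle_le_pi _ _)]

theorem arccos_quarter_norm_lt_angle {p q : ℂ} (hp : p ≠ 0) (hq : q ≠ 0) (hp2 : ‖p‖ ≤ 2)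
    (hq2 : ‖q‖ ≤ 2) (hpq : 2 < ‖p - q‖) : Real.arccos (‖p‖ / 4) < angle p q := by
  have hp' := norm_pos_iff.2 hp
  have hq' := norm_pos_iff.2 hq
  have hc : Real.cos (angle p q) < ‖p‖ / 4 := by
    rw [cos_angle_eq_div hp hq, div_lt_iff₀ (by positivity)]
    nlinarith [mul_nonneg (sub_nonneg.2 hq2) (sub_nonneg.2 hp2),
      mul_nonneg (mul_nonneg (sub_nonneg.2 hq2) (sub_nonneg.2 hp2)) hp'.le,
      mul_nonneg (sub_nonneg.2 hq2) hq'.le]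
  rw [← Real.arccos_cos (angle_nonneg p q) (angle_le_pi p q)]
  exact Real.arccos_lt_arccos (Real.neg_one_le_cos _) hc (by linarith)

theorem pi_div_three_le_arccos_quarter {x : ℝ} (hx : x ≤ 2) :
    Real.pi / 3 ≤ Real.arccos (x / 4) := by
  have h : Real.pi / 3 = Real.arccos (1 / 2) := by
    rw [← Real.cos_pi_div_three, Real.arccos_cos] <;> linarith [Real.pi_pos]
  rw [h]
  exact Real.arccos_le_arccos (by linarith)

theorem arccos_sub_arccos_antitone {L s r : ℝ} (hs : 0 < s) (hsr : s ≤ r) (hr : r ≤ 2)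
    (hL : 2 ≤ L) (hLs : L ≤ s + 2) :
    Real.arccos (r / 4) - Real.arccos ((L ^ 2 + r ^ 2 - 4) / (2 * L * r)) ≤
      Real.arccos (s / 4) - Real.arccos ((L ^ 2 + s ^ 2 - 4) / (2 * L * s)) := by
  let g : ℝ → ℝ := fun x => Real.arccos (x / 4) - Real.arccos ((L ^ 2 + x ^ 2 - 4) / (2 * L * x))
  have hanti : AntitoneOn g (Set.Icc s r) := by
    refine antitoneOn_of_hasDerivWithinAt_nonpos (convex_Icc s r) (f' := fun x =>
      -(1 / √(1 - (x / 4) ^ 2)) * (1 / 4) - -(1 / √(1 - ((L ^ 2 + x ^ 2 - 4) / (2 * L * x)) ^ 2)) *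
        ((2 * x * (2 * L * x) - (L ^ 2 + x ^ 2 - 4) * (2 * L)) / (2 * L * x) ^ 2)) ?_ ?_ ?_
    · have : ∀ x ∈ Set.Icc s r, 2 * L * x ≠ 0 := fun x hx => by
        have := hx.1; nlinarith
      fun_prop (disch := assumption)
    · intro x hx
      rw [interior_Icc] at hx
      obtain ⟨hx1, hx2⟩ := hx
      have hx0 : 0 < x := by linarith
      have hD : 0 < 2 * L * x := by nlinarith
      have hy : (L ^ 2 + x ^ 2 - 4) / (2 * L * x) < 1 := by
        rw [div_lt_one hD]; nlinarith
      have hy' : -1 < (L ^ 2 + x ^ 2 - 4) / (2 * L * x) := by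
        rw [lt_div_iff₀ hD]; nlinarith
      refine HasDerivAt.hasDerivWithinAt ?_
      have h1 : HasDerivAt (fun x : ℝ => x / 4) (1 / 4) x := (hasDerivAt_id x).div_const 4
      have h2 : HasDerivAt (fun x : ℝ => (L ^ 2 + x ^ 2 - 4) / (2 * L * x))
          ((2 * x * (2 * L * x) - (L ^ 2 + x ^ 2 - 4) * (2 * L)) / (2 * L * x) ^ 2) x := by
        refine HasDerivAt.fun_div (𝕜 := ℝ) ?_ ?_ hD.ne'
        · have := ((hasDerivAt_pow 2 x).const_add (L ^ 2)).sub_const 4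
          simpa using this
        · simpa using (hasDerivAt_id x).const_mul (2 * L)
      have h3 := (Real.hasDerivAt_arccos (x := x / 4) (by linarith) (by linarith)).comp x h1
      have h4 := (Real.hasDerivAt_arccos hy'.ne' hy.ne).comp x h2
      exact h3.sub h4
    · intro x hx
      rw [interior_Icc] at hx
      obtain ⟨hx1, hx2⟩ := hx
      have hx0 : 0 < x := by linarith
      have hL0 : 0 < L := by linarith
      have hD : 0 < 2 * L * x := by nlinarith
      have hy : (L ^ 2 + x ^ 2 - 4) / (2 * L * x) < 1 := by
        rw [div_lt_one hD]; nlinarith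
      have hy' : -1 < (L ^ 2 + x ^ 2 - 4) / (2 * L * x) := by
        rw [lt_div_iff₀ hD]; nlinarith
      set y := (L ^ 2 + x ^ 2 - 4) / (2 * L * x) with hydef
      have hN : 0 < 1 - y ^ 2 := by nlinarith
      have hM : 0 < 1 - (x / 4) ^ 2 := by nlinarith
      have hder : (2 * x * (2 * L * x) - (L ^ 2 + x ^ 2 - 4) * (2 * L)) / (2 * L * x) ^ 2
          = (x ^ 2 - L ^ 2 + 4) / (2 * L * x ^ 2) := by
        field_simp; ring
      rw [hder]
      have key : (x ^ 2 - L ^ 2 + 4) / (2 * L * x ^ 2) * √(1 - (x / 4) ^ 2) ≤ 1 / 4 * √(1 - y ^ 2) := by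
        rcases le_or_gt (x ^ 2 - L ^ 2 + 4) 0 with hneg | hpos
        · exact (mul_nonpos_of_nonpos_of_nonneg (div_nonpos_of_nonpos_of_nonneg hneg
            (by positivity)) (by positivity)).trans (by positivity)
        refine abs_le_of_sq_le_sq' ?_ (by positivity) |>.2
        rw [mul_pow, mul_pow, Real.sq_sqrt hM.le, Real.sq_sqrt hN.le, hydef, ← sub_nonneg]
        have hMX : (x ^ 2 - L ^ 2 + 4) ^ 2 ≤ (x ^ 2) ^ 2 := by
          have : x ^ 2 - L ^ 2 + 4 ≤ x ^ 2 := by nlinarith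
          gcongr
        have hdiff : (1 / 4) ^ 2 * (1 - ((L ^ 2 + x ^ 2 - 4) / (2 * L * x)) ^ 2) -
            ((x ^ 2 - L ^ 2 + 4) / (2 * L * x ^ 2)) ^ 2 * (1 - (x / 4) ^ 2) =
            ((x ^ 2) ^ 2 - (x ^ 2 - L ^ 2 + 4) ^ 2) / (4 * L ^ 2 * (x ^ 2) ^ 2) := by
          field_simp
          ring
        rw [hdiff]
        exact div_nonneg (sub_nonneg.2 hMX) (by positivity)
      have h3 : (1 / √(1 - y ^ 2)) * ((x ^ 2 - L ^ 2 + 4) / (2 * L * x ^ 2)) ≤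
          1 / √(1 - (x / 4) ^ 2) * (1 / 4) := by
        have a := Real.sqrt_pos.2 hN
        have b := Real.sqrt_pos.2 hM
        rw [one_div_mul_eq_div, one_div_mul_eq_div, div_le_div_iff₀ a b]
        exact key
      linarith
  exact hanti ⟨le_rfl, hsr⟩ ⟨hsr, le_rfl⟩ hsr

theorem angle_eq_angle_add_angle_of_norm {U A C : ℂ} (hU : U ≠ 0) (hU2 : ‖U‖ ≤ 2)
    (hAU : ‖A - U‖ ≤ 2) (hC : ‖C‖ ≤ 2) (hA : 2 < ‖A‖) (hCU : 2 < ‖C - U‖)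
    (him : 0 < (A / U).im * (C / U).im) : angle U C = angle U A + angle A C := by
  have hA0 : A ≠ 0 := norm_pos_iff.1 (by linarith)
  have hy0 : (C / U).im ≠ 0 := fun h => by simp [h] at him
  set mu : ℝ := (A / U).im / (C / U).im with hmu
  set la : ℝ := (A / U).re - mu * (C / U).re with hla
  have hmu0 : 0 < mu := by
    rw [hmu, ← mul_div_mul_right _ _ hy0]
    exact div_pos him (mul_self_pos.2 hy0)
  have hAeq : A = la * U + mu * C := by
    have : A / U = la + mu * (C / U) := by
      apply Complex.ext
      · simp [hla]
      · simp [hmu]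
        field_simp
    field_simp at this
    linear_combination this
  refine (angle_eq_angle_add_angle_iff hA0).2 (Or.inr ?_)
  rcases le_or_gt 0 la with hl | hl
  · rw [Submodule.mem_span_pair]
    clear_value la mu
    lift la to NNReal using hl
    lift mu to NNReal using hmu0.le
    refine ⟨la, mu, ?_⟩
    rw [hAeq, NNReal.smul_def, NNReal.smul_def, Complex.real_smul, Complex.real_smul]
  · exfalso
    set p : ℝ := 1 / mu with hp
    set q : ℝ := -la / mu with hq
    have hp0 : 0 < p := by positivity
    have hq0 : 0 < q := div_pos (by linarith) hmu0
    have hCeq : C = p * A + q * U := by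
      rw [hAeq, hp, hq]
      have : (mu : ℂ) ≠ 0 := by exact_mod_cast hmu0.ne'
      push_cast
      field_simp
      ring
    rcases le_or_gt (p + q) 1 with h1 | h1
    · have h2 : ‖C - U‖ ≤ p * ‖A - U‖ + (1 - p - q) * ‖U‖ := by
        have : C - U = (p : ℝ) • (A - U) - ((1 - p - q : ℝ)) • U := by
          rw [Complex.real_smul, Complex.real_smul, hCeq]; push_cast; ring
        rw [this]
        refine (norm_sub_le _ _).trans_eq ?_
        rw [norm_smul, norm_smul, Real.norm_of_nonneg hp0.le, Real.norm_of_nonneg (by linarith)]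
      nlinarith [norm_nonneg U]
    · have hpq : 0 < p + q := by linarith
      have hpq' : ((p : ℂ) + q) ≠ 0 := by exact_mod_cast hpq.ne'
      have e1 : ‖C - U‖ ≤ (1 - 1 / (p + q)) * ‖C‖ + p / (p + q) * ‖A - U‖ := by
        have : C - U = ((1 - 1 / (p + q) : ℝ)) • C + ((p / (p + q) : ℝ)) • (A - U) := by
          rw [Complex.real_smul, Complex.real_smul, hCeq]; push_cast; field_simp; ring
        rw [this]
        refine (norm_add_le _ _).trans_eq ?_
        have h0 : 0 ≤ 1 - 1 / (p + q) := by rw [sub_nonneg, div_le_one hpq]; exact h1.le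
        rw [norm_smul, norm_smul, Real.norm_of_nonneg h0, Real.norm_of_nonneg (by positivity)]
      have e2 : ‖A‖ ≤ (1 / (p + q)) * ‖C‖ + q / (p + q) * ‖A - U‖ := by
        have : A = ((1 / (p + q) : ℝ)) • C + ((q / (p + q) : ℝ)) • (A - U) := by
          rw [Complex.real_smul, Complex.real_smul, hCeq]; push_cast; field_simp; ring
        conv_lhs => rw [this]
        refine (norm_add_le _ _).trans_eq ?_
        rw [norm_smul, norm_smul, Real.norm_of_nonneg (by positivity),
          Real.norm_of_nonneg (by positivity)]
      have e3 : p / (p + q) + q / (p + q) = 1 := by field_simp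
      nlinarith [norm_nonneg (A - U)]

theorem angle_add_angle_ge_aux {p q w : ℂ} (hp : p ≠ 0) (hw : w ≠ 0) (hw2 : ‖w‖ ≤ 2)
    (hpq : ‖p‖ ≤ ‖q‖) (hq2 : ‖q‖ ≤ 2) (hpw : 2 < ‖p - w‖) (hqw : 2 < ‖q + w‖)
    (hd : 2 < ‖p - w - q‖) (him : (p / w).im * (q / -w).im < 0) :
    5 * Real.pi / 3 ≤ angle p w + Real.arccos (‖p‖ / 4) +
      (angle q (-w) + Real.arccos (‖q‖ / 4)) := by
  have hp0 := norm_pos_iff.2 hp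
  have hq : q ≠ 0 := norm_pos_iff.1 (by linarith)
  have hA : p - w ≠ 0 := norm_pos_iff.1 (by linarith)
  have hsum := angle_add_angle_sub_add_angle_sub_eq_pi p hw
  have hbet : angle (-w) q = angle (-w) (p - w) + angle (p - w) q := by
    refine angle_eq_angle_add_angle_of_norm (neg_ne_zero.2 hw) (by simpa) (by simp; linarith) hq2
      hpw (by simpa using hqw) ?_
    have : (p - w) / -w = 1 - p / w := by field_simp; ring
    rw [this, Complex.sub_im, Complex.one_im]
    linarith
  have e1 : angle w (w - p) = angle (-w) (p - w) := by
    rw [← angle_neg_neg, neg_sub]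
  have hL : ‖p - w‖ ≤ ‖p‖ + 2 := (norm_sub_le _ _).trans (by linarith)
  have h1 : angle p (p - w) ≤
      Real.arccos ((‖p - w‖ ^ 2 + ‖p‖ ^ 2 - 4) / (2 * ‖p - w‖ * ‖p‖)) := by
    rw [angle_eq_arccos_div hp hA]
    apply Real.arccos_le_arccos
    rw [sub_sub_cancel]
    have : ‖w‖ ^ 2 ≤ 4 := by nlinarith [norm_nonneg w]
    rw [div_le_div_iff₀ (by positivity) (by positivity)]
    have : 0 < ‖p - w‖ * ‖p‖ := by positivity
    nlinarith
  have h2 : Real.arccos ((‖p - w‖ ^ 2 + ‖q‖ ^ 2 - 4) / (2 * ‖p - w‖ * ‖q‖)) ≤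
      angle (p - w) q := by
    rw [angle_eq_arccos_div hA hq]
    apply Real.arccos_le_arccos
    have : 4 ≤ ‖p - w - q‖ ^ 2 := by nlinarith
    gcongr
  have h3 := arccos_sub_arccos_antitone hp0 hpq hq2 hpw.le hL
  have h4 := pi_div_three_le_arccos_quarter hq2
  rw [angle_comm q (-w)]
  linarith

theorem angle_add_angle_ge {p q w : ℂ} (hp : p ≠ 0) (hq : q ≠ 0) (hw : w ≠ 0) (hw2 : ‖w‖ ≤ 2)
    (hp2 : ‖p‖ ≤ 2) (hq2 : ‖q‖ ≤ 2) (hpw : 2 < ‖p - w‖) (hqw : 2 < ‖q + w‖)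
    (hd : 2 < ‖p - w - q‖) (him : (p / w).im * (q / -w).im < 0) :
    5 * Real.pi / 3 ≤ angle p w + Real.arccos (‖p‖ / 4) +
      (angle q (-w) + Real.arccos (‖q‖ / 4)) := by
  rcases le_total ‖p‖ ‖q‖ with h | h
  · exact angle_add_angle_ge_aux hp hw hw2 h hq2 hpw hqw hd him
  · have := angle_add_angle_ge_aux (p := q) (q := p) (w := -w) hq (neg_ne_zero.2 hw) (by simpa) h hp2
      (by simpa using hqw) (by simpa [sub_eq_add_neg] using hpw)
      (by rw [← norm_neg]; convert hd using 1; congr 1; ring) (by simpa [mul_comm] using him)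
    rw [neg_neg] at this
    linarith

/-- The argument of a complex number, normalized to `[0, 2π)`. -/
noncomputable def posArg (z : ℂ) : ℝ := if z.arg < 0 then z.arg + 2 * Real.pi else z.arg

theorem posArg_nonneg (z : ℂ) : 0 ≤ posArg z := by
  have := Complex.neg_pi_lt_arg z
  unfold posArg; split_ifs <;> linarith

theorem posArg_lt (z : ℂ) : posArg z < 2 * Real.pi := by
  have := Complex.arg_le_pi z
  have := Real.pi_pos
  unfold posArg; split_ifs <;> linarith

theorem posArg_coe (z : ℂ) : (posArg z : Real.Angle) = z.arg := by
  unfold posArg; split_ifs <;> simp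

theorem abs_le_abs_of_eq_add_two_pi_mul {a D : ℝ} (ha : |a| ≤ Real.pi) (hD : |D| < 2 * Real.pi)
    {k : ℤ} (h : a - D = 2 * Real.pi * k) : |a| ≤ |D| ∧ |a| ≤ 2 * Real.pi - |D| := by
  have hpi := Real.pi_pos
  rw [abs_le] at ha
  rw [abs_lt] at hD
  have hk1 : (k : ℝ) < 2 := by nlinarith
  have hk2 : (-2 : ℝ) < k := by nlinarith
  have hk1' : k < 2 := by exact_mod_cast hk1
  have hk2' : -2 < k := by exact_mod_cast hk2
  obtain rfl | rfl | rfl : k = -1 ∨ k = 0 ∨ k = 1 := by omega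
  all_goals
    push_cast at h
    rcases abs_cases a with h1 | h1 <;> rcases abs_cases D with h2 | h2 <;>
      constructor <;> linarith

theorem angle_le_posArg {p q w : ℂ} (hp : p ≠ 0) (hq : q ≠ 0) (hw : w ≠ 0) :
    angle p q ≤ |posArg (p / w) - posArg (q / w)| ∧
      angle p q ≤ 2 * Real.pi - |posArg (p / w) - posArg (q / w)| := by
  rw [Complex.angle_eq_abs_arg hp hq]
  have h : ((p / q).arg : Real.Angle) = ((posArg (p / w) - posArg (q / w) : ℝ) : Real.Angle) := by
    rw [Real.Angle.coe_sub, posArg_coe, posArg_coe,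
      ← Complex.arg_div_coe_angle (div_ne_zero hp hw) (div_ne_zero hq hw),
      div_div_div_cancel_right₀ hw]
  obtain ⟨k, hk⟩ := Real.Angle.angle_eq_iff_two_pi_dvd_sub.1 h
  refine abs_le_abs_of_eq_add_two_pi_mul (Complex.abs_arg_le_pi _) ?_ hk
  rw [abs_lt]
  constructor <;> linarith [posArg_nonneg (p / w), posArg_nonneg (q / w), posArg_lt (p / w),
    posArg_lt (q / w)]

theorem posArg_one : posArg 1 = 0 := by simp [posArg]

theorem angle_le_posArg' {p w : ℂ} (hp : p ≠ 0) (hw : w ≠ 0) :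
    angle p w ≤ posArg (p / w) ∧ angle p w ≤ 2 * Real.pi - posArg (p / w) := by
  have := angle_le_posArg hp hw hw
  rwa [div_self hw, posArg_one, sub_zero, abs_of_nonneg (posArg_nonneg _)] at this

theorem im_pos_of_posArg {z : ℂ} (h0 : 0 < posArg z) (hpi : posArg z < Real.pi) : 0 < z.im := by
  unfold posArg at h0 hpi
  have := Complex.neg_pi_lt_arg z
  split_ifs at h0 hpi with h
  · linarith
  · have hz : z ≠ 0 := by rintro rfl; simp at h0
    rw [← Complex.norm_mul_sin_arg]
    exact mul_pos (norm_pos_iff.2 hz) (Real.sin_pos_of_pos_of_lt_pi h0 hpi)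

theorem im_neg_of_posArg {z : ℂ} (h : Real.pi < posArg z) : z.im < 0 := by
  unfold posArg at h
  split_ifs at h with h'
  · exact Complex.arg_neg_iff.1 h'
  · linarith [Complex.arg_le_pi z]

theorem sorted_gap {n : ℕ} {w : ℂ} {z : Fin n → ℂ} (hw : w ≠ 0) (hz : ∀ i, z i ≠ 0)
    (hz2 : ∀ i, ‖z i‖ ≤ 2) (hd : ∀ i j, i ≠ j → 2 < ‖z i - z j‖) {i j : Fin n} (hij : i ≠ j)
    (hle : posArg (z i / w) ≤ posArg (z j / w)) :
    posArg (z i / w) + Real.arccos (‖z i‖ / 4) < posArg (z j / w) ∧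
    posArg (z i / w) + Real.arccos (‖z j‖ / 4) < posArg (z j / w) ∧
    posArg (z i / w) + Real.pi / 3 < posArg (z j / w) := by
  have h1 := arccos_quarter_norm_lt_angle (hz i) (hz j) (hz2 i) (hz2 j) (hd i j hij)
  have h2 := arccos_quarter_norm_lt_angle (hz j) (hz i) (hz2 j) (hz2 i) (hd j i hij.symm)
  rw [angle_comm] at h2
  have h3 := (angle_le_posArg (hz i) (hz j) hw).1
  rw [abs_sub_comm, abs_of_nonneg (by linarith)] at h3
  have h4 := pi_div_three_le_arccos_quarter (hz2 i)
  refine ⟨?_, ?_, ?_⟩ <;> linarith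

theorem exists_fan {w : ℂ} {z : Fin 4 → ℂ} (hw : w ≠ 0) (hw2 : ‖w‖ ≤ 2) (hz : ∀ i, z i ≠ 0)
    (hz2 : ∀ i, ‖z i‖ ≤ 2) (hd : ∀ i j, i ≠ j → 2 < ‖z i - z j‖) (hzw : ∀ i, 2 < ‖z i - w‖) :
    ∃ i j, 0 < (z i / w).im ∧ (z j / w).im < 0 ∧
      angle (z i) w + Real.arccos (‖z i‖ / 4) + (angle (z j) w + Real.arccos (‖z j‖ / 4)) <
        5 * Real.pi / 3 := by
  set f : Fin 4 → ℝ := fun i => posArg (z i / w) with hf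
  set σ := Tuple.sort f
  have hm := Tuple.monotone_sort f
  have g : ∀ i j : Fin 4, i < j → _ := fun i j hij => sorted_gap hw hz hz2 hd
    (σ.injective.ne hij.ne) (hm hij.le)
  obtain ⟨a1, a2, a3⟩ := g 0 1 (by decide)
  obtain ⟨b1, b2, b3⟩ := g 1 2 (by decide)
  obtain ⟨c1, c2, c3⟩ := g 2 3 (by decide)
  have h0 := (angle_le_posArg' (hz (σ 0)) hw)
  have h3 := (angle_le_posArg' (hz (σ 3)) hw)
  have h5 := arccos_quarter_norm_lt_angle (hz (σ 0)) hw (hz2 _) hw2 (hzw _)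
  have h6 := Real.arccos_nonneg (‖z (σ 0)‖ / 4)
  have h7 := posArg_lt (z (σ 3) / w)
  refine ⟨σ 0, σ 3, im_pos_of_posArg ?_ ?_, im_neg_of_posArg ?_, ?_⟩ <;> linarith

theorem no_six_star {w : ℂ} {z : Fin 5 → ℂ} (hw : w ≠ 0) (hw2 : ‖w‖ ≤ 2) (hz : ∀ i, z i ≠ 0)
    (hz2 : ∀ i, ‖z i‖ ≤ 2) (hd : ∀ i j, i ≠ j → 2 < ‖z i - z j‖) (hzw : ∀ i, 2 < ‖z i - w‖) :
    False := by
  set f : Fin 5 → ℝ := fun i => posArg (z i / w) with hf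
  set σ := Tuple.sort f
  have hm := Tuple.monotone_sort f
  have g : ∀ i j : Fin 5, i < j → _ := fun i j hij => sorted_gap hw hz hz2 hd
    (σ.injective.ne hij.ne) (hm hij.le)
  obtain ⟨-, -, a3⟩ := g 0 1 (by decide)
  obtain ⟨-, -, b3⟩ := g 1 2 (by decide)
  obtain ⟨-, -, c3⟩ := g 2 3 (by decide)
  obtain ⟨-, -, d3⟩ := g 3 4 (by decide)
  have h0 := (angle_le_posArg' (hz (σ 0)) hw)
  have h3 := (angle_le_posArg' (hz (σ 4)) hw)
  have h5 := arccos_quarter_norm_lt_angle (hz (σ 0)) hw (hz2 _) hw2 (hzw _)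
  have h6 := arccos_quarter_norm_lt_angle (hz (σ 4)) hw (hz2 _) hw2 (hzw _)
  have h7 := pi_div_three_le_arccos_quarter (hz2 (σ 0))
  have h8 := pi_div_three_le_arccos_quarter (hz2 (σ 4))
  linarith

theorem SimpleGraph.IsAcyclic.not_adj_of_adj_adj {V : Type*} {G : SimpleGraph V}
    (h : G.IsAcyclic) {u a b : V} (ha : G.Adj u a) (hb : G.Adj u b) : ¬ G.Adj a b := by
  intro hab
  have := (h.subsingleton_path a b).elim (SimpleGraph.Path.singleton hab)
    ⟨.cons ha.symm (.cons hb .nil), by simp [ha.ne', hb.ne, hab.ne]⟩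
  have := congrArg (fun p => p.1.length) this
  simp [SimpleGraph.Path.singleton] at this

theorem SimpleGraph.IsAcyclic.not_adj_of_adj_adj_adj {V : Type*} {G : SimpleGraph V}
    (h : G.IsAcyclic) {u v a c : V} (huv : G.Adj u v) (ha : G.Adj u a) (hav : a ≠ v)
    (hc : G.Adj v c) (hcu : c ≠ u) : a ≠ c ∧ ¬ G.Adj a c := by
  have hac : a ≠ c := by
    rintro rfl
    exact h.not_adj_of_adj_adj huv ha hc
  refine ⟨hac, fun hadj => ?_⟩
  have := (h.subsingleton_path a c).elim (SimpleGraph.Path.singleton hadj)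
    ⟨.cons ha.symm (.cons huv (.cons hc .nil)), by
      simp [ha.ne', hc.ne, huv.ne, hac, hav, hcu.symm]⟩
  have := congrArg (fun p => p.1.length) this
  simp [SimpleGraph.Path.singleton] at this

section Necessity

variable {V : Type*} {G : SimpleGraph V} {d : V → ℂ}

theorem sub_ne_zero_of_adj (hG : G.IsAcyclic)
    (hd : ∀ u v, u ≠ v → (G.Adj u v ↔ ‖d u - d v‖ ≤ 2)) {u a b : V}
    (ha : G.Adj u a) (hb : G.Adj u b) (hab : a ≠ b) : d a - d u ≠ 0 := by
  intro h
  rw [sub_eq_zero] at h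
  refine hG.not_adj_of_adj_adj ha hb ((hd a b hab).2 ?_)
  rw [h]
  exact (hd u b hb.ne).1 hb

theorem norm_sub_gt_of_adj (hG : G.IsAcyclic)
    (hd : ∀ u v, u ≠ v → (G.Adj u v ↔ ‖d u - d v‖ ≤ 2)) {u a b : V}
    (ha : G.Adj u a) (hb : G.Adj u b) (hab : a ≠ b) :
    2 < ‖(d a - d u) - (d b - d u)‖ := by
  rw [sub_sub_sub_cancel_right, ← not_le, ← hd a b hab]
  exact hG.not_adj_of_adj_adj ha hb

variable [Fintype V] [DecidableRel G.Adj]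

theorem degree_le_five (hG : G.IsAcyclic)
    (hd : ∀ u v, u ≠ v → (G.Adj u v ↔ ‖d u - d v‖ ≤ 2)) (u : V) : G.degree u ≤ 5 := by
  classical
  by_contra! hdeg
  obtain ⟨v, hv⟩ : (G.neighborFinset u).Nonempty := by
    rw [← Finset.card_pos, G.card_neighborFinset_eq_degree]; omega
  obtain ⟨t, ht, htc⟩ := Finset.exists_subset_card_eq (s := (G.neighborFinset u).erase v) (n := 5)
    (by rw [Finset.card_erase_of_mem hv, G.card_neighborFinset_eq_degree]; omega)
  let e := (Finset.equivFinOfCardEq htc).symm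
  rw [SimpleGraph.mem_neighborFinset] at hv
  have he : ∀ i, (e i : V) ≠ v ∧ G.Adj u (e i) := fun i => by
    simpa using ht (e i).2
  refine no_six_star (w := d v - d u) (z := fun i => d (e i) - d u)
    (sub_ne_zero_of_adj hG hd hv (he 0).2 (he 0).1.symm) ((hd v u hv.ne').1 hv.symm)
    (fun i => sub_ne_zero_of_adj hG hd (he i).2 hv (he i).1)
    (fun i => (hd _ _ (he i).2.ne').1 (he i).2.symm)
    (fun i j hij => norm_sub_gt_of_adj hG hd (he i).2 (he j).2 fun h =>
      hij (e.injective (Subtype.ext h)))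
    (fun i => norm_sub_gt_of_adj hG hd (he i).2 hv (he i).1)

theorem exists_fan_of_adj (hG : G.IsAcyclic)
    (hd : ∀ u v, u ≠ v → (G.Adj u v ↔ ‖d u - d v‖ ≤ 2)) {u v : V} (huv : G.Adj u v)
    (hu : G.degree u = 5) : ∃ a b, (G.Adj u a ∧ a ≠ v) ∧ (G.Adj u b ∧ b ≠ v) ∧
      0 < ((d a - d u) / (d v - d u)).im ∧ ((d b - d u) / (d v - d u)).im < 0 ∧
      angle (d a - d u) (d v - d u) + Real.arccos (‖d a - d u‖ / 4) +
        (angle (d b - d u) (d v - d u) + Real.arccos (‖d b - d u‖ / 4)) < 5 * Real.pi / 3 := by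
  classical
  have htc : ((G.neighborFinset u).erase v).card = 4 := by
    rw [Finset.card_erase_of_mem (by simpa), G.card_neighborFinset_eq_degree, hu]
  let e := (Finset.equivFinOfCardEq htc).symm
  have he : ∀ i, (e i : V) ≠ v ∧ G.Adj u (e i) := fun i => by
    have := (e i).2
    rwa [Finset.mem_erase, SimpleGraph.mem_neighborFinset] at this
  obtain ⟨i, j, h1, h2, h3⟩ := exists_fan (w := d v - d u) (z := fun i => d (e i) - d u)
    (sub_ne_zero_of_adj hG hd huv (he 0).2 (he 0).1.symm) ((hd v u huv.ne').1 huv.symm)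
    (fun i => sub_ne_zero_of_adj hG hd (he i).2 huv (he i).1)
    (fun i => (hd _ _ (he i).2.ne').1 (he i).2.symm)
    (fun i j hij => norm_sub_gt_of_adj hG hd (he i).2 (he j).2 fun h =>
      hij (e.injective (Subtype.ext h)))
    (fun i => norm_sub_gt_of_adj hG hd (he i).2 huv (he i).1)
  exact ⟨e i, e j, (he i).symm, (he j).symm, h1, h2, h3⟩

theorem not_degree_eq_five_of_adj (hG : G.IsAcyclic)
    (hd : ∀ u v, u ≠ v → (G.Adj u v ↔ ‖d u - d v‖ ≤ 2)) {u v : V} (huv : G.Adj u v) :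
    ¬ (G.degree u = 5 ∧ G.degree v = 5) := by
  rintro ⟨hu, hv⟩
  obtain ⟨a, b, ⟨ha, hav⟩, ⟨hb, hbv⟩, ha', hb', hab⟩ := exists_fan_of_adj hG hd huv hu
  obtain ⟨c, c', ⟨hc, hcu⟩, ⟨hc', hcu'⟩, hc1, hc2, hcc⟩ := exists_fan_of_adj hG hd huv.symm hv
  have quad : ∀ a c, G.Adj u a → a ≠ v → G.Adj v c → c ≠ u →
      ((d a - d u) / (d v - d u)).im * ((d c - d v) / (d u - d v)).im < 0 →
      5 * Real.pi / 3 ≤ angle (d a - d u) (d v - d u) + Real.arccos (‖d a - d u‖ / 4) +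
        (angle (d c - d v) (d u - d v) + Real.arccos (‖d c - d v‖ / 4)) := by
    intro a c ha hav hc hcu him
    have hneg : d u - d v = -(d v - d u) := (neg_sub _ _).symm
    rw [hneg] at him ⊢
    obtain ⟨hac, hnac⟩ := hG.not_adj_of_adj_adj_adj huv ha hav hc hcu
    refine angle_add_angle_ge (sub_ne_zero_of_adj hG hd ha huv hav)
      (sub_ne_zero_of_adj hG hd hc huv.symm hcu) (sub_ne_zero_of_adj hG hd huv ha hav.symm)
      ((hd v u huv.ne').1 huv.symm) ((hd a u ha.ne').1 ha.symm) ((hd c v hc.ne').1 hc.symm)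
      (norm_sub_gt_of_adj hG hd ha huv hav) ?_ ?_ him
    · have := norm_sub_gt_of_adj hG hd hc huv.symm hcu
      rwa [hneg, sub_neg_eq_add] at this
    · rw [hd a c hac, not_le] at hnac
      rwa [show d a - d u - (d v - d u) - (d c - d v) = d a - d c by ring]
  have q1 := quad a c' ha hav hc' hcu' (by nlinarith)
  have q2 := quad b c hb hbv hc hcu (by nlinarith)
  linarith

end Necessity

/-- A placement of a chain of `n + 1` stars: `P i 0` is the center of the `i`-th star, whose leaves
are `P i 1`, `P i 2` and, if `t i` holds, `P i 3`; consecutive centers are adjacent. -/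
structure IsChainPlacement (n : ℕ) (t : ℕ → Prop) (P : ℕ → Fin 4 → ℂ) : Prop where
  leaf_le : ∀ i ≤ n, ∀ k, k ≠ 0 → (k = 3 → t i) → ‖P i k - P i 0‖ ≤ 2
  leaf_far : ∀ i ≤ n, ∀ k l, k ≠ 0 → l ≠ 0 → k ≠ l → (k = 3 → t i) → (l = 3 → t i) →
    2 < ‖P i k - P i l‖
  hub_le : ∀ i, i + 1 ≤ n → ‖P i 0 - P (i + 1) 0‖ ≤ 2
  far : ∀ i j, i < j → j ≤ n → ∀ k l, (k = 3 → t i) → (l = 3 → t j) →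
    ¬ (j = i + 1 ∧ k = 0 ∧ l = 0) → 2 < ‖P i k - P j l‖

/-- Put the star `Q` in front of the chain `P`. -/
def consStar (Q : Fin 4 → ℂ) (P : ℕ → Fin 4 → ℂ) : ℕ → Fin 4 → ℂ
  | 0 => Q
  | i + 1 => P i

theorem IsChainPlacement.map {n : ℕ} {t : ℕ → Prop} {P : ℕ → Fin 4 → ℂ}
    (h : IsChainPlacement n t P) {T : ℂ → ℂ} (hT : ∀ z w, ‖T z - T w‖ = ‖z - w‖) :
    IsChainPlacement n t (fun i k => T (P i k)) := by
  constructor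
  · simpa only [hT] using h.leaf_le
  · simpa only [hT] using h.leaf_far
  · simpa only [hT] using h.hub_le
  · simpa only [hT] using h.far

theorem IsChainPlacement.cons {n : ℕ} {t : ℕ → Prop} {P : ℕ → Fin 4 → ℂ} {Q : Fin 4 → ℂ}
    (h : IsChainPlacement n (fun i => t (i + 1)) P)
    (hle : ∀ k, k ≠ 0 → (k = 3 → t 0) → ‖Q k - Q 0‖ ≤ 2)
    (hfar : ∀ k l, k ≠ 0 → l ≠ 0 → k ≠ l → (k = 3 → t 0) → (l = 3 → t 0) → 2 < ‖Q k - Q l‖)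
    (hhub : ‖Q 0 - P 0 0‖ ≤ 2)
    (hcross : ∀ j ≤ n, ∀ k l, (k = 3 → t 0) → (l = 3 → t (j + 1)) →
      ¬ (j = 0 ∧ k = 0 ∧ l = 0) → 2 < ‖Q k - P j l‖) :
    IsChainPlacement (n + 1) t (consStar Q P) := by
  constructor
  · rintro (_ | i) hi k hk hk3
    · exact hle k hk hk3
    · exact h.leaf_le i (by omega) k hk hk3
  · rintro (_ | i) hi k l hk hl hkl hk3 hl3
    · exact hfar k l hk hl hkl hk3 hl3
    · exact h.leaf_far i (by omega) k l hk hl hkl hk3 hl3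
  · rintro (_ | i) hi
    · exact hhub
    · exact h.hub_le i (by omega)
  · rintro (_ | i) (_ | j) hij hj k l hk3 hl3 hne
    · omega
    · exact hcross j (by omega) k l hk3 hl3 (by simpa using hne)
    · omega
    · exact h.far i j (by omega) (by omega) k l hk3 hl3 (by simpa using hne)

/-- A chain placement whose first star is in standard position, with parameter `s`, and whose
other points are well separated from the left of that star. -/
structure IsStandardPlacement (n : ℕ) (t : ℕ → Prop) (s : ℝ) (P : ℕ → Fin 4 → ℂ) : Prop where
  chain : IsChainPlacement n t P
  pos : 0 < s
  le : s ≤ 1 / 1000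
  hub : P 0 0 = 0
  up : P 0 1 = ⟨0, s⟩
  down : P 0 2 = ⟨2 * Real.sin (10 * s), -2 * Real.cos (10 * s)⟩
  re_gt : ∀ i ≤ n, ∀ k, (k = 3 → t i) → -1 < (P i k).re
  slant_gt : ∀ i ≤ n, ∀ k, (k = 3 → t i) → -3 / 2 < √3 / 2 * (P i k).re + 1 / 2 * (P i k).im
  norm_le : ∀ i ≤ n, ∀ k, (k = 3 → t i) → s * ‖P i k‖ ≤ 1 / 100
  one_lt_re : ∀ i, 0 < i → i ≤ n → ∀ k, (k = 3 → t i) → 1 < (P i k).re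

theorem two_lt_norm_of_sq {z : ℂ} (h : 4 < z.re ^ 2 + z.im ^ 2) : 2 < ‖z‖ := by
  have := Complex.sq_norm z
  rw [Complex.normSq_apply] at this
  nlinarith [norm_nonneg z]

theorem norm_le_two_of_sq {z : ℂ} (h : z.re ^ 2 + z.im ^ 2 ≤ 4) : ‖z‖ ≤ 2 := by
  have := Complex.sq_norm z
  rw [Complex.normSq_apply] at this
  nlinarith [norm_nonneg z]

theorem two_lt_norm_of_linear {z : ℂ} (a b : ℝ) (hab : a ^ 2 + b ^ 2 ≤ 1)
    (h : 2 < a * z.re + b * z.im) : 2 < ‖z‖ := by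
  refine two_lt_norm_of_sq ?_
  nlinarith [sq_nonneg (a * z.im - b * z.re), sq_nonneg z.re, sq_nonneg z.im]

theorem sin_mul_bounds {s : ℝ} (hs : 0 < s) (hs' : s ≤ 1 / 1000) (k : ℝ) (hk : 0 < k)
    (hk' : k ≤ 10) : 0 < Real.sin (k * s) ∧ Real.sin (k * s) ≤ 1 / 100 ∧
      99 / 100 ≤ Real.cos (k * s) ∧ Real.cos (k * s) ≤ 1 := by
  have h1 : 0 < k * s := by positivity
  have h2 : k * s ≤ 1 / 100 := by nlinarith
  refine ⟨Real.sin_pos_of_pos_of_lt_pi h1 (by linarith [Real.pi_gt_three]),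
    (Real.sin_lt h1).le.trans h2, ?_, Real.cos_le_one _⟩
  have := Real.one_sub_sq_div_two_le_cos (x := k * s)
  nlinarith

theorem sin_mul_lt_sin_mul {s : ℝ} (hs : 0 < s) (hs' : s ≤ 1 / 1000) {k l : ℝ} (hk : 0 < k)
    (hkl : k < l) (hl : l ≤ 10) : Real.sin (k * s) < Real.sin (l * s) := by
  have h1 : 0 < k * s := by positivity
  refine Real.sin_lt_sin_of_lt_of_le_pi_div_two (by linarith [Real.pi_gt_three]) ?_ (by gcongr)
  have : l * s ≤ 1 / 100 := by nlinarith
  linarith [Real.pi_gt_three]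

theorem re_sin_sq_add_cos_sq (x : ℝ) : (2 * Real.sin x) ^ 2 + (-2 * Real.cos x) ^ 2 = 4 := by
  linear_combination 4 * Real.sin_sq_add_cos_sq x

/-- The star with two leaves in standard position. -/
noncomputable def smallStar (s : ℝ) : Fin 4 → ℂ :=
  ![0, ⟨0, s⟩, ⟨2 * Real.sin (10 * s), -2 * Real.cos (10 * s)⟩, 0]

theorem smallStar_le {s : ℝ} (hs : 0 < s) (hs' : s ≤ 1 / 1000) {t : ℕ → Prop} (ht : ¬ t 0) :
    ∀ k, k ≠ 0 → (k = 3 → t 0) →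
    ‖smallStar s k - smallStar s 0‖ ≤ 2 := by
  intro k hk hk3
  fin_cases k
  · simp at hk
  · refine norm_le_two_of_sq ?_
    simp [smallStar]
    nlinarith
  · refine norm_le_two_of_sq ?_
    simpa [smallStar] using (re_sin_sq_add_cos_sq (10 * s)).le
  · exact absurd (hk3 rfl) ht

theorem smallStar_far {s : ℝ} (hs : 0 < s) (hs' : s ≤ 1 / 1000) {t : ℕ → Prop} (ht : ¬ t 0) :
    ∀ k l, k ≠ 0 → l ≠ 0 → k ≠ l → (k = 3 → t 0) → (l = 3 → t 0) → 2 < ‖smallStar s k - smallStar s l‖ := by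
  have h := sin_mul_bounds hs hs' 10 (by norm_num) le_rfl
  have h12 : 2 < ‖smallStar s 1 - smallStar s 2‖ := by
    refine two_lt_norm_of_sq ?_
    simp [smallStar]
    nlinarith [re_sin_sq_add_cos_sq (10 * s)]
  intro k l hk hl hkl hk3 hl3
  fin_cases k <;> fin_cases l <;> first
    | exact absurd rfl hk
    | exact absurd rfl hl
    | exact absurd rfl hkl
    | exact absurd (hk3 rfl) ht
    | exact absurd (hl3 rfl) ht
    | exact h12
    | (rw [norm_sub_rev]; exact h12)

theorem smallStar_region {s : ℝ} (hs : 0 < s) (hs' : s ≤ 1 / 1000) {t : ℕ → Prop} (ht : ¬ t 0)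
    (k : Fin 4) (hk3 : k = 3 → t 0) :
    -1 < (smallStar s k).re ∧ (smallStar s k).re ≤ 1 / 50 ∧
    -3 / 2 < √3 / 2 * (smallStar s k).re + 1 / 2 * (smallStar s k).im ∧
    s * ‖smallStar s k‖ ≤ 1 / 100 := by
  have h := sin_mul_bounds hs hs' 10 (by norm_num) le_rfl
  have hn : ‖smallStar s k‖ ≤ 2 := by
    by_cases hk : k = 0
    · simp [hk, smallStar]
    · simpa [smallStar] using smallStar_le hs hs' ht k hk hk3
  refine ⟨?_, ?_, ?_, by nlinarith⟩ <;> fin_cases k <;>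
    first
      | exact absurd (hk3 rfl) ht
      | (have := Real.sqrt_nonneg 3; simp [smallStar]; try nlinarith)

theorem isStandardPlacement_zero {t : ℕ → Prop} (ht : ¬ t 0) {s : ℝ} (hs : 0 < s)
    (hs' : s ≤ 1 / 1000) : IsStandardPlacement 0 t s (fun _ => smallStar s) where
  chain :=
    { leaf_le := fun i hi => by
        obtain rfl : i = 0 := by omega
        exact smallStar_le hs hs' ht
      leaf_far := fun i hi => by
        obtain rfl : i = 0 := by omega
        exact smallStar_far hs hs' ht
      hub_le := fun i hi => by omega
      far := fun i j hij hj => by omega }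
  pos := hs
  le := hs'
  hub := rfl
  up := rfl
  down := rfl
  re_gt := fun i hi k hk3 => by
    obtain rfl : i = 0 := by omega
    exact (smallStar_region hs hs' ht k hk3).1
  slant_gt := fun i hi k hk3 => by
    obtain rfl : i = 0 := by omega
    exact (smallStar_region hs hs' ht k hk3).2.2.1
  norm_le := fun i hi k hk3 => by
    obtain rfl : i = 0 := by omega
    exact (smallStar_region hs hs' ht k hk3).2.2.2
  one_lt_re := fun i hi hi' => by omega

/-- Putting a small star in front of a chain all of whose points are far enough to the right. -/
theorem IsChainPlacement.cons_smallStar {n : ℕ} {t : ℕ → Prop} {P : ℕ → Fin 4 → ℂ} {s : ℝ}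
    (h : IsChainPlacement n (fun i => t (i + 1)) P) (ht : ¬ t 0) (hs : 0 < s) (hs' : s ≤ 1 / 1000)
    (hhub : ‖smallStar s 0 - P 0 0‖ ≤ 2)
    (hcross : ∀ j ≤ n, ∀ k l, (k = 3 → t 0) → (l = 3 → t (j + 1)) →
      ¬ (j = 0 ∧ k = 0 ∧ l = 0) → 2 < ‖smallStar s k - P j l‖)
    (hre : ∀ i ≤ n, ∀ k, (k = 3 → t (i + 1)) → 1 < (P i k).re)
    (hslant : ∀ i ≤ n, ∀ k, (k = 3 → t (i + 1)) →
      -3 / 2 < √3 / 2 * (P i k).re + 1 / 2 * (P i k).im)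
    (hnorm : ∀ i ≤ n, ∀ k, (k = 3 → t (i + 1)) → s * ‖P i k‖ ≤ 1 / 100) :
    IsStandardPlacement (n + 1) t s (consStar (smallStar s) P) where
  chain := h.cons (smallStar_le hs hs' ht) (smallStar_far hs hs' ht) hhub hcross
  pos := hs
  le := hs'
  hub := rfl
  up := rfl
  down := rfl
  re_gt
    | 0, _, k, hk3 => (smallStar_region hs hs' ht k hk3).1
    | i + 1, hi, k, hk3 => by
      have := hre i (by omega) k hk3
      simp only [consStar]; linarith
  slant_gt
    | 0, _, k, hk3 => (smallStar_region hs hs' ht k hk3).2.2.1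
    | i + 1, hi, k, hk3 => hslant i (by omega) k hk3
  norm_le
    | 0, _, k, hk3 => (smallStar_region hs hs' ht k hk3).2.2.2
    | i + 1, hi, k, hk3 => hnorm i (by omega) k hk3
  one_lt_re
    | 0, h0, _, _, _ => absurd h0 (lt_irrefl 0)
    | i + 1, _, hi, k, hk3 => hre i (by omega) k hk3

theorem two_lt_norm_of_re {z : ℂ} (h : 2 < z.re) : 2 < ‖z‖ :=
  h.trans_le (Complex.re_le_norm z)

theorem IsStandardPlacement.cons_small {n : ℕ} {t : ℕ → Prop} {P : ℕ → Fin 4 → ℂ} {s : ℝ}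
    (h : IsStandardPlacement n (fun i => t (i + 1)) s P) (ht : ¬ t 0) (ht1 : ¬ t 1) :
    IsStandardPlacement (n + 1) t (s / 2) (consStar (smallStar (s / 2)) (fun i k => P i k + 2)) := by
  have hs := h.pos
  have hs' := h.le
  have h10 := sin_mul_bounds hs hs' 10 (by norm_num) le_rfl
  have h5 := sin_mul_bounds hs hs' 5 (by norm_num) (by norm_num)
  have h510 := sin_mul_lt_sin_mul hs hs' (k := 5) (l := 10) (by norm_num) (by norm_num) (by norm_num)
  have e5 : 10 * (s / 2) = 5 * s := by ring
  refine IsChainPlacement.cons_smallStar (t := t) (h.chain.map (T := fun z => z + 2) (by simp)) ht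
    (by positivity) (by linarith) ?_ ?_ ?_ ?_ ?_
  · simp [smallStar, h.hub]
  · rintro (_ | j) hj k l hk3 hl3 hne
    · have x2 : s ^ 2 > 0 := by positivity
      fin_cases k <;> fin_cases l <;> first
        | exact absurd (hk3 rfl) ht
        | exact absurd (hl3 rfl) ht1
        | exact absurd ⟨rfl, rfl, rfl⟩ hne
        | (refine two_lt_norm_of_sq ?_
           simp [smallStar, h.hub, h.up, h.down, e5]
           nlinarith)
    · have h1 := h.one_lt_re (j + 1) (by omega) hj l hl3
      have h2 := smallStar_region (s := s / 2) (by positivity) (by linarith) ht k hk3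
      rw [norm_sub_rev]
      refine two_lt_norm_of_re ?_
      simp only [Complex.sub_re, Complex.add_re, Complex.re_ofNat]
      linarith
  · intro i hi k hk3
    have := h.re_gt i hi k hk3
    simp; linarith
  · intro i hi k hk3
    have := h.slant_gt i hi k hk3
    have := Real.sqrt_nonneg 3
    simp only [Complex.add_re, Complex.re_ofNat, Complex.add_im, Complex.im_ofNat]
    linarith
  · intro i hi k hk3
    have := h.norm_le i hi k hk3
    have h2 := norm_add_le (P i k) 2
    rw [RCLike.norm_ofNat] at h2
    nlinarith

/-- The reflection mapping the standard frame of a chain to the frame of the star two places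
before it, when the star in between has five neighbours. -/
noncomputable def turn (s : ℝ) (z : ℂ) : ℂ :=
  ⟨2 + Real.cos (Real.pi / 6 + 8 * s) * (z.re + 2) + Real.sin (Real.pi / 6 + 8 * s) * z.im,
    Real.sin (Real.pi / 6 + 8 * s) * (z.re + 2) - Real.cos (Real.pi / 6 + 8 * s) * z.im⟩

theorem norm_turn_sub_turn (s : ℝ) (z w : ℂ) : ‖turn s z - turn s w‖ = ‖z - w‖ := by
  rw [← sq_eq_sq₀ (norm_nonneg _) (norm_nonneg _), Complex.sq_norm, Complex.sq_norm,
    Complex.normSq_apply, Complex.normSq_apply]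
  simp only [turn, Complex.sub_re, Complex.sub_im]
  linear_combination ((z.re - w.re) ^ 2 + (z.im - w.im) ^ 2) *
    Real.sin_sq_add_cos_sq (Real.pi / 6 + 8 * s)

theorem turn_polar (s θ : ℝ) : turn s ⟨-2 + 2 * Real.cos θ, 2 * Real.sin θ⟩ =
    ⟨2 + 2 * Real.cos (Real.pi / 6 + 8 * s - θ), 2 * Real.sin (Real.pi / 6 + 8 * s - θ)⟩ := by
  simp only [turn, Real.cos_sub, Real.sin_sub, Complex.mk.injEq]
  constructor <;> ring

theorem turn_region {s : ℝ} (hs : 0 < s) (hs' : s ≤ 1 / 1000) {z : ℂ} (hre : -1 < z.re)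
    (hslant : -3 / 2 < √3 / 2 * z.re + 1 / 2 * z.im) (hnorm : s * ‖z‖ ≤ 1 / 100) :
    204 / 100 < (turn s z).re ∧ -3 / 2 < √3 / 2 * (turn s z).re + 1 / 2 * (turn s z).im ∧
      s / 2 * ‖turn s z‖ ≤ 1 / 100 := by
  have hc := Real.abs_cos_sub_cos_le (Real.pi / 6 + 8 * s) (Real.pi / 6)
  have hd := Real.abs_sin_sub_sin_le (Real.pi / 6 + 8 * s) (Real.pi / 6)
  rw [add_sub_cancel_left, abs_of_pos (by positivity : 0 < 8 * s)] at hc hd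
  rw [Real.cos_pi_div_six] at hc
  rw [Real.sin_pi_div_six] at hd
  obtain ⟨a, ha⟩ : ∃ a, Real.cos (Real.pi / 6 + 8 * s) = √3 / 2 + a :=
    ⟨_, (add_sub_cancel _ _).symm⟩
  obtain ⟨b, hb⟩ : ∃ b, Real.sin (Real.pi / 6 + 8 * s) = 1 / 2 + b :=
    ⟨_, (add_sub_cancel _ _).symm⟩
  have hzn : ‖turn s z‖ ≤ ‖z‖ + 4 := by
    have h1 := norm_turn_sub_turn s z (-2)
    have h2 : turn s (-2) = 2 := by apply Complex.ext <;> simp [turn]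
    have h3 := norm_sub_norm_le (turn s z) 2
    have h4 := norm_sub_le z (-2)
    rw [h2] at h1
    rw [norm_neg, RCLike.norm_ofNat] at h4
    rw [RCLike.norm_ofNat] at h3
    linarith
  have hzs : s / 2 * ‖turn s z‖ ≤ 1 / 100 := by nlinarith
  rw [← and_assoc]
  refine ⟨?_, hzs⟩
  simp only [turn, ha, hb, add_sub_cancel_left] at hc hd ⊢
  have e1 : |a * z.re| ≤ 8 / 100 := by
    rw [abs_mul]
    nlinarith [Complex.abs_re_le_norm z, abs_nonneg z.re, abs_nonneg a]
  have e2 : |a * z.im| ≤ 8 / 100 := by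
    rw [abs_mul]
    nlinarith [Complex.abs_im_le_norm z, abs_nonneg z.im, abs_nonneg a]
  have e3 : |b * z.re| ≤ 8 / 100 := by
    rw [abs_mul]
    nlinarith [Complex.abs_re_le_norm z, abs_nonneg z.re, abs_nonneg b]
  have e4 : |b * z.im| ≤ 8 / 100 := by
    rw [abs_mul]
    nlinarith [Complex.abs_im_le_norm z, abs_nonneg z.im, abs_nonneg b]
  rw [abs_le] at hc hd e1 e2 e3 e4
  have h3 : √3 * √3 = 3 := Real.mul_self_sqrt (by norm_num)
  have h3a : 173 / 100 < √3 := Real.lt_sqrt_of_sq_lt (by norm_num)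
  have h3b : √3 < 2 := by nlinarith
  refine ⟨by linarith, ?_⟩
  have : √3 / 2 * (2 + (√3 / 2 + a) * (z.re + 2) + (1 / 2 + b) * z.im) +
      1 / 2 * ((1 / 2 + b) * (z.re + 2) - (√3 / 2 + a) * z.im) =
      √3 + 2 + √3 * a + b + z.re + √3 / 2 * (a * z.re) + √3 / 2 * (b * z.im) +
      1 / 2 * (b * z.re) - 1 / 2 * (a * z.im) := by
    linear_combination (1 / 4) * (z.re + 2) * h3
  rw [this]
  nlinarith

/-- The star with three leaves, in the frame of the chain that it precedes. -/
noncomputable def bigStar (s : ℝ) : Fin 4 → ℂ :=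
  ![-2, ⟨-2 + 2 * Real.cos (Real.pi / 3 + s), 2 * Real.sin (Real.pi / 3 + s)⟩,
    ⟨-2 + 2 * Real.cos (2 * (Real.pi / 3 + s)), 2 * Real.sin (2 * (Real.pi / 3 + s))⟩,
    ⟨-2 + 2 * Real.sin (9 * s), -2 * Real.cos (9 * s)⟩]

theorem turn_bigStar_zero (s : ℝ) : turn s (bigStar s 0) = 2 := by
  apply Complex.ext <;> simp [turn, bigStar]

theorem turn_bigStar_one (s : ℝ) : turn s (bigStar s 1) =
    ⟨2 + 2 * Real.cos (Real.pi / 6 - 7 * s), -2 * Real.sin (Real.pi / 6 - 7 * s)⟩ := by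
  refine (turn_polar s _).trans ?_
  rw [show Real.pi / 6 + 8 * s - (Real.pi / 3 + s) = -(Real.pi / 6 - 7 * s) by ring, Real.cos_neg,
    Real.sin_neg, neg_mul, mul_neg]

theorem turn_bigStar_two (s : ℝ) : turn s (bigStar s 2) =
    ⟨2 + 2 * Real.sin (6 * s), -2 * Real.cos (6 * s)⟩ := by
  refine (turn_polar s _).trans ?_
  rw [show Real.pi / 6 + 8 * s - 2 * (Real.pi / 3 + s) = 6 * s - Real.pi / 2 by ring,
    Real.cos_sub_pi_div_two, Real.sin_sub_pi_div_two, neg_mul, mul_neg]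

theorem turn_bigStar_three (s : ℝ) : turn s (bigStar s 3) =
    ⟨2 - 2 * Real.cos (Real.pi / 3 + s), 2 * Real.sin (Real.pi / 3 + s)⟩ := by
  have : bigStar s 3 = ⟨-2 + 2 * Real.cos (9 * s - Real.pi / 2),
      2 * Real.sin (9 * s - Real.pi / 2)⟩ := by
    rw [Real.cos_sub_pi_div_two, Real.sin_sub_pi_div_two, mul_neg, ← neg_mul]
    rfl
  rw [this, turn_polar,
    show Real.pi / 6 + 8 * s - (9 * s - Real.pi / 2) = Real.pi - (Real.pi / 3 + s) by ring,
    Real.cos_pi_sub, Real.sin_pi_sub, mul_neg, ← sub_eq_add_neg]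

theorem sin_cos_pi_div_three_add_bounds {s : ℝ} (hs : 0 < s) (hs' : s ≤ 1 / 1000) :
    49 / 100 ≤ Real.cos (Real.pi / 3 + s) ∧ s < 1 - 2 * Real.cos (Real.pi / 3 + s) ∧
      86 / 100 ≤ Real.sin (Real.pi / 3 + s) ∧ Real.sin (Real.pi / 3 + s) ≤ 87 / 100 := by
  have h3a : 1732 / 1000 < √3 := Real.lt_sqrt_of_sq_lt (by norm_num)
  have h3b : √3 < 1733 / 1000 := (Real.sqrt_lt' (by norm_num)).2 (by norm_num)
  have h := Real.sin_gt_sub_cube hs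
  have h' := Real.sin_lt hs
  have hc := Real.one_sub_sq_div_two_le_cos (x := s)
  have hc' := Real.cos_le_one s
  have hs3 : s ^ 3 ≤ s * (1 / 1000) := by
    rw [pow_succ']; gcongr; nlinarith
  rw [Real.cos_add, Real.sin_add, Real.cos_pi_div_three, Real.sin_pi_div_three]
  refine ⟨?_, ?_, ?_, ?_⟩ <;> nlinarith

theorem bigStar_le (s : ℝ) (k : Fin 4) (hk : k ≠ 0) : ‖bigStar s k - bigStar s 0‖ ≤ 2 := by
  refine norm_le_two_of_sq (le_of_eq ?_)
  fin_cases k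
  · exact absurd rfl hk
  · simp [bigStar]
    linear_combination 4 * Real.sin_sq_add_cos_sq (Real.pi / 3 + s)
  · simp [bigStar]
    linear_combination 4 * Real.sin_sq_add_cos_sq (2 * (Real.pi / 3 + s))
  · simp [bigStar]
    linear_combination 4 * Real.sin_sq_add_cos_sq (9 * s)

theorem bigStar_far {s : ℝ} (hs : 0 < s) (hs' : s ≤ 1 / 1000) (k l : Fin 4) (hk : k ≠ 0)
    (hl : l ≠ 0) (hkl : k ≠ l) : 2 < ‖bigStar s k - bigStar s l‖ := by
  obtain ⟨c1, c2, s1, s2⟩ := sin_cos_pi_div_three_add_bounds hs hs'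
  have h9 := sin_mul_bounds hs hs' 9 (by norm_num) (by norm_num)
  have hsc := Real.sin_sq_add_cos_sq (Real.pi / 3 + s)
  have h12 : 2 < ‖bigStar s 1 - bigStar s 2‖ := by
    refine two_lt_norm_of_sq ?_
    simp [bigStar, Real.cos_two_mul, Real.sin_two_mul]
    nlinarith
  have h13 : 2 < ‖bigStar s 1 - bigStar s 3‖ := by
    refine two_lt_norm_of_linear 0 1 (by norm_num) ?_
    simp [bigStar]
    linarith
  have h23 : 2 < ‖bigStar s 2 - bigStar s 3‖ := by
    refine two_lt_norm_of_linear 0 1 (by norm_num) ?_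
    simp [bigStar, Real.sin_two_mul]
    nlinarith
  fin_cases k <;> fin_cases l <;> first
    | exact absurd rfl hk
    | exact absurd rfl hl
    | exact absurd rfl hkl
    | assumption
    | (rw [norm_sub_rev]; assumption)

theorem bigStar_re {s : ℝ} (hs : 0 < s) (hs' : s ≤ 1 / 1000) (k : Fin 4) :
    (bigStar s k).re ≤ -1 := by
  obtain ⟨c1, c2, s1, s2⟩ := sin_cos_pi_div_three_add_bounds hs hs'
  have h9 := sin_mul_bounds hs hs' 9 (by norm_num) (by norm_num)
  fin_cases k <;> simp [bigStar, Real.cos_two_mul] <;> nlinarith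

theorem two_lt_norm_bigStar_sub_smallStar {s : ℝ} (hs : 0 < s) (hs' : s ≤ 1 / 1000) (k l : Fin 4)
    (hl : l ≠ 3) (hkl : ¬ (k = 0 ∧ l = 0)) : 2 < ‖bigStar s k - smallStar s l‖ := by
  obtain ⟨c1, c2, s1, s2⟩ := sin_cos_pi_div_three_add_bounds hs hs'
  have h9 := sin_mul_bounds hs hs' 9 (by norm_num) (by norm_num)
  have h10 := sin_mul_bounds hs hs' 10 (by norm_num) (by norm_num)
  have h910 := sin_mul_lt_sin_mul hs hs' (k := 9) (l := 10) (by norm_num) (by norm_num) le_rfl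
  have hsc := Real.sin_sq_add_cos_sq (Real.pi / 3 + s)
  have hs2 : 0 < s ^ 2 := by positivity
  refine two_lt_norm_of_sq ?_
  fin_cases k <;> fin_cases l <;> first
    | exact absurd rfl hl
    | exact absurd ⟨rfl, rfl⟩ hkl
    | (simp [bigStar, smallStar, Real.cos_two_mul, Real.sin_two_mul]
       nlinarith)

theorem pi_div_six_sub_bounds {s : ℝ} (hs : 0 < s) (hs' : s ≤ 1 / 1000) :
    86 / 100 ≤ Real.cos (Real.pi / 6 - 7 * s) ∧ 49 / 100 ≤ Real.sin (Real.pi / 6 - 7 * s) ∧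
      Real.sin (Real.pi / 6 - 7 * s) ≤ 1 / 2 := by
  have h3 : 1732 / 1000 < √3 := Real.lt_sqrt_of_sq_lt (by norm_num)
  have h3b : √3 < 1733 / 1000 := (Real.sqrt_lt' (by norm_num)).2 (by norm_num)
  have h := Real.sin_gt_sub_cube (x := 7 * s) (by positivity)
  have h' := Real.sin_lt (x := 7 * s) (by positivity)
  have hc := Real.one_sub_sq_div_two_le_cos (x := 7 * s)
  have hc' := Real.cos_le_one (7 * s)
  have hs3 : s ^ 3 ≤ s * (1 / 1000000) := by
    rw [pow_succ']; gcongr; nlinarith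
  rw [Real.cos_sub, Real.sin_sub, Real.cos_pi_div_six, Real.sin_pi_div_six]
  refine ⟨?_, ?_, ?_⟩ <;> nlinarith

theorem two_lt_norm_smallStar_sub_turn_bigStar {s : ℝ} (hs : 0 < s) (hs' : s ≤ 1 / 1000)
    (k l : Fin 4) (hk : k ≠ 3) (hkl : ¬ (k = 0 ∧ l = 0)) :
    2 < ‖smallStar (s / 2) k - turn s (bigStar s l)‖ := by
  obtain ⟨c1, c2, s1, s2⟩ := sin_cos_pi_div_three_add_bounds hs hs'
  obtain ⟨c3, s3, s4⟩ := pi_div_six_sub_bounds hs hs'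
  have h6 := sin_mul_bounds hs hs' 6 (by norm_num) (by norm_num)
  have h5 := sin_mul_bounds hs hs' 5 (by norm_num) (by norm_num)
  have h56 := sin_mul_lt_sin_mul hs hs' (k := 5) (l := 6) (by norm_num) (by norm_num) (by norm_num)
  have hsc := Real.sin_sq_add_cos_sq (Real.pi / 3 + s)
  have hs2 : 0 < s ^ 2 := by positivity
  have e5 : 10 * (s / 2) = 5 * s := by ring
  refine two_lt_norm_of_sq ?_
  fin_cases l
  on_goal 1 => simp only [Fin.zero_eta, turn_bigStar_zero]
  on_goal 2 => simp only [Fin.mk_one, turn_bigStar_one]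
  on_goal 3 => simp only [Fin.reduceFinMk, turn_bigStar_two]
  on_goal 4 => simp only [Fin.reduceFinMk, turn_bigStar_three]
  all_goals fin_cases k <;> first
    | exact absurd rfl hk
    | exact absurd ⟨rfl, rfl⟩ hkl
    | (simp [smallStar, e5]
       nlinarith)

theorem turn_bigStar_region {s : ℝ} (hs : 0 < s) (hs' : s ≤ 1 / 1000) (k : Fin 4) :
    1 < (turn s (bigStar s k)).re ∧
      -3 / 2 < √3 / 2 * (turn s (bigStar s k)).re + 1 / 2 * (turn s (bigStar s k)).im ∧
      s / 2 * ‖turn s (bigStar s k)‖ ≤ 1 / 100 := by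
  obtain ⟨c1, c2, s1, s2⟩ := sin_cos_pi_div_three_add_bounds hs hs'
  obtain ⟨c3, s3, s4⟩ := pi_div_six_sub_bounds hs hs'
  have h6 := sin_mul_bounds hs hs' 6 (by norm_num) (by norm_num)
  have h3 : 1732 / 1000 < √3 := Real.lt_sqrt_of_sq_lt (by norm_num)
  have hn : ‖turn s (bigStar s k)‖ ≤ 4 := by
    have h1 : ‖turn s (bigStar s k) - turn s (bigStar s 0)‖ ≤ 2 := by
      rw [norm_turn_sub_turn]
      by_cases hk : k = 0
      · simp [hk]
      · exact bigStar_le s k hk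
    have h2 := norm_sub_norm_le (turn s (bigStar s k)) (turn s (bigStar s 0))
    rw [turn_bigStar_zero, RCLike.norm_ofNat, ← turn_bigStar_zero s] at h2
    linarith
  rw [← and_assoc]
  refine ⟨?_, by nlinarith⟩
  fin_cases k
  on_goal 1 => simp only [Fin.zero_eta, turn_bigStar_zero, Complex.re_ofNat, Complex.im_ofNat]
  on_goal 2 => simp only [Fin.mk_one, turn_bigStar_one]
  on_goal 3 => simp only [Fin.reduceFinMk, turn_bigStar_two]
  on_goal 4 => simp only [Fin.reduceFinMk, turn_bigStar_three]
  all_goals constructor <;> nlinarith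

theorem IsStandardPlacement.first_eq_smallStar {n : ℕ} {t : ℕ → Prop} {P : ℕ → Fin 4 → ℂ} {s : ℝ}
    (h : IsStandardPlacement n t s P) {k : Fin 4} (hk : k ≠ 3) : P 0 k = smallStar s k := by
  fin_cases k
  · exact h.hub
  · exact h.up
  · exact h.down
  · exact absurd rfl hk

theorem IsStandardPlacement.cons_big {n : ℕ} {t : ℕ → Prop} {P : ℕ → Fin 4 → ℂ} {s : ℝ}
    (h : IsStandardPlacement n (fun i => t (i + 2)) s P) (ht : ¬ t 0) (ht2 : ¬ t 2) :
    IsStandardPlacement (n + 2) t (s / 2) (consStar (smallStar (s / 2))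
      (fun i k => turn s (consStar (bigStar s) P i k))) := by
  have hs := h.pos
  have hs' := h.le
  have hchain : IsChainPlacement (n + 1) (fun i => t (i + 1)) (consStar (bigStar s) P) := by
    refine IsChainPlacement.cons (t := fun i => t (i + 1)) h.chain (fun k hk _ => bigStar_le s k hk)
      (fun k l hk hl hkl _ _ => bigStar_far hs hs' k l hk hl hkl) ?_ ?_
    · simp [h.hub, bigStar]
    · rintro (_ | j) hj k l - hl3 hne
      · have hl : l ≠ 3 := fun hl => ht2 (hl3 hl)
        rw [h.first_eq_smallStar hl]
        exact two_lt_norm_bigStar_sub_smallStar hs hs' k l hl (by simpa using hne)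
      · have h1 := h.one_lt_re (j + 1) (by omega) hj l hl3
        have h2 := bigStar_re hs hs' k
        rw [norm_sub_rev]
        refine two_lt_norm_of_re ?_
        rw [Complex.sub_re]
        linarith
  have hregion : ∀ i ≤ n, ∀ k : Fin 4, (k = 3 → t (i + 2)) → _ := fun i hi k hk3 =>
    turn_region hs hs' (h.re_gt i hi k hk3) (h.slant_gt i hi k hk3) (h.norm_le i hi k hk3)
  refine IsChainPlacement.cons_smallStar (t := t) (hchain.map (norm_turn_sub_turn s)) ht
    (by positivity) (by linarith) ?_ ?_ ?_ ?_ ?_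
  · simp [consStar, turn_bigStar_zero, smallStar]
  · rintro (_ | j) hj k l hk3 hl3 hne
    · exact two_lt_norm_smallStar_sub_turn_bigStar hs hs' k l (fun hk => ht (hk3 hk))
        (by simpa using hne)
    · have h1 := (hregion j (by omega) l hl3).1
      have h2 := (smallStar_region (s := s / 2) (by positivity) (by linarith) ht k hk3).2.1
      rw [norm_sub_rev]
      refine two_lt_norm_of_re ?_
      rw [Complex.sub_re, consStar]
      linarith
  · rintro (_ | i) hi k hk3
    · exact (turn_bigStar_region hs hs' k).1
    · have := (hregion i (by omega) k hk3).1
      rw [consStar]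
      linarith
  · rintro (_ | i) hi k hk3
    · exact (turn_bigStar_region hs hs' k).2.1
    · exact (hregion i (by omega) k hk3).2.1
  · rintro (_ | i) hi k hk3
    · exact (turn_bigStar_region hs hs' k).2.2
    · exact (hregion i (by omega) k hk3).2.2

theorem exists_isStandardPlacement (n : ℕ) : ∀ t : ℕ → Prop, ¬ t 0 → ¬ t n →
    (∀ i, ¬ (t i ∧ t (i + 1))) → ∃ s P, IsStandardPlacement n t s P := by
  induction n using Nat.strong_induction_on with
  | _ n ih =>
    intro t h0 hn htt
    match n with
    | 0 => exact ⟨_, _, isStandardPlacement_zero h0 (s := 1 / 1000) (by norm_num) le_rfl⟩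
    | 1 =>
      obtain ⟨s, P, h⟩ := ih 0 (by omega) (fun i => t (i + 1)) hn hn fun i => htt (i + 1)
      exact ⟨_, _, h.cons_small h0 hn⟩
    | n + 2 =>
      by_cases h1 : t 1
      · have h2 : ¬ t 2 := fun h2 => htt 1 ⟨h1, h2⟩
        obtain ⟨s, P, h⟩ := ih n (by omega) (fun i => t (i + 2)) h2 hn fun i => htt (i + 2)
        exact ⟨_, _, h.cons_big h0 h2⟩
      · obtain ⟨s, P, h⟩ := ih (n + 1) (by omega) (fun i => t (i + 1)) h1 hn fun i => htt (i + 1)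
        exact ⟨_, _, h.cons_small h0 h1⟩

/-- Adjacency in the infinite caterpillar with vertex `(i, 0)` in the middle of the `i`-th star and
the leaves `(i, 1)`, `(i, 2)`, `(i, 3)` attached to it. -/
def SlotAdj (p q : ℕ × Fin 4) : Prop :=
  (p.1 = q.1 ∧ p.2 ≠ q.2 ∧ (p.2 = 0 ∨ q.2 = 0)) ∨
    (p.2 = 0 ∧ q.2 = 0 ∧ (p.1 + 1 = q.1 ∨ q.1 + 1 = p.1))

theorem SlotAdj.symm {p q : ℕ × Fin 4} (h : SlotAdj p q) : SlotAdj q p := by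
  unfold SlotAdj at *; tauto

theorem SlotAdj.comm {p q : ℕ × Fin 4} : SlotAdj p q ↔ SlotAdj q p :=
  ⟨SlotAdj.symm, SlotAdj.symm⟩

theorem IsChainPlacement.norm_le_two_iff {n : ℕ} {t : ℕ → Prop} {P : ℕ → Fin 4 → ℂ}
    (h : IsChainPlacement n t P) {p q : ℕ × Fin 4} (hpq : p ≠ q) (hp : p.1 ≤ n) (hq : q.1 ≤ n)
    (hp3 : p.2 = 3 → t p.1) (hq3 : q.2 = 3 → t q.1) :
    ‖P p.1 p.2 - P q.1 q.2‖ ≤ 2 ↔ SlotAdj p q := by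
  wlog hle : p.1 ≤ q.1 generalizing p q
  · rw [norm_sub_rev, SlotAdj.comm]
    exact this hpq.symm hq hp hq3 hp3 (by omega)
  obtain ⟨i, k⟩ := p
  obtain ⟨j, l⟩ := q
  simp only at *
  rcases hle.eq_or_lt with rfl | hlt
  · have hkl : k ≠ l := fun hkl => hpq (by rw [hkl])
    by_cases hk : k = 0
    · subst hk
      rw [norm_sub_rev]
      exact iff_of_true (h.leaf_le i hp l hkl.symm hq3) (Or.inl ⟨rfl, hkl, Or.inl rfl⟩)
    · by_cases hl : l = 0
      · subst hl
        exact iff_of_true (h.leaf_le i hp k hkl hp3) (Or.inl ⟨rfl, hkl, Or.inr rfl⟩)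
      · refine iff_of_false (h.leaf_far i hp k l hk hl hkl hp3 hq3).not_ge ?_
        simp [SlotAdj, hk, hl]
  · by_cases hc : j = i + 1 ∧ k = 0 ∧ l = 0
    · obtain ⟨rfl, rfl, rfl⟩ := hc
      exact iff_of_true (h.hub_le i hq) (Or.inr ⟨rfl, rfl, Or.inl rfl⟩)
    · refine iff_of_false (h.far i j hlt hq k l hp3 hq3 hc).not_ge ?_
      rintro (⟨h1, -⟩ | ⟨h1, h2, h3⟩)
      · exact hlt.ne h1
      · simp only at h1 h2 h3
        exact hc ⟨by omega, h1, h2⟩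

theorem SlotAdj.eq_of_not_hub {m j j' : ℕ} {q : ℕ × Fin 4} (hq : ∀ i < m, q ≠ (i + 1, 0))
    (hj : j < m) (hj' : j' < m) (h : SlotAdj q (j + 1, 0)) (h' : SlotAdj q (j' + 1, 0)) :
    j = j' := by
  obtain ⟨i, k⟩ := q
  have hq' : k = 0 → i = 0 ∨ m < i := fun hk => by
    by_contra! hc
    refine hq (i - 1) (by omega) ?_
    rw [hk, Nat.sub_add_cancel (by omega)]
  simp only [SlotAdj] at h h'
  rcases h with ⟨h1, h2, -⟩ | ⟨h1, -, h2⟩ <;> rcases h' with ⟨h3, h4, -⟩ | ⟨h3, -, h4⟩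
  · omega
  · exact absurd h3 h2
  · exact absurd h1 h4
  · have := hq' h1
    omega

theorem SlotAdj.not_adj_of_not_hub {m j j' : ℕ} {q q' : ℕ × Fin 4}
    (hq : ∀ i < m, q ≠ (i + 1, 0)) (hq' : ∀ i < m, q' ≠ (i + 1, 0))
    (hj : j < m) (hj' : j' < m) (h : SlotAdj q (j + 1, 0)) (h' : SlotAdj q' (j' + 1, 0)) :
    ¬ SlotAdj q q' := by
  obtain ⟨i, k⟩ := q
  obtain ⟨i', k'⟩ := q'
  have aux : ∀ i (k : Fin 4), (∀ i₁ < m, (i, k) ≠ (i₁ + 1, 0)) → k = 0 → i = 0 ∨ m < i :=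
    fun i k hq hk => by
      by_contra! hc
      refine hq (i - 1) (by omega) ?_
      rw [hk, Nat.sub_add_cancel (by omega)]
  have a := aux i k hq
  have a' := aux i' k' hq'
  simp only [SlotAdj] at h h' ⊢
  by_cases hk : k = 0 <;> by_cases hk' : k' = 0 <;> simp [hk, hk'] at * <;> omega

theorem SimpleGraph.Connected.eq_or_eq_of_degree_le_one {V : Type*} [Fintype V]
    {G : SimpleGraph V} [DecidableRel G.Adj] (hG : G.Connected) {u p : V} (hup : G.Adj u p)
    (hu : G.degree u ≤ 1) (hp : G.degree p ≤ 1) (x : V) : x = u ∨ x = p := by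
  have aux : ∀ a b c : V, G.degree a ≤ 1 → G.Adj a b → G.Adj a c → b = c := by
    intro a b c ha hab hac
    rw [← G.card_neighborFinset_eq_degree, Finset.card_le_one] at ha
    exact ha b (by simpa) c (by simpa)
  have h := (SimpleGraph.reachable_iff_reflTransGen u x).1 (hG.preconnected u x)
  induction h with
  | refl => exact Or.inl rfl
  | tail _ hbc ih =>
    rcases ih with rfl | rfl
    · exact Or.inr (aux _ _ _ hu hbc hup)
    · exact Or.inl (aux _ _ _ hp hbc hup.symm)

theorem exists_injOn_leaf_slots {V : Type*} [Fintype V] {G : SimpleGraph V} [DecidableRel G.Adj]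
    {m : ℕ} (e : {v : V | 2 ≤ G.degree v} ≃ Fin m)
    (he : ∀ a b, (G.induce {v : V | 2 ≤ G.degree v}).Adj a b ↔
      ((e a : ℕ) + 1 = (e b : ℕ) ∨ (e b : ℕ) + 1 = (e a : ℕ)))
    (b : {v : V | 2 ≤ G.degree v}) (hb : G.degree b ≤ 5) :
    ∃ g : V → ℕ × Fin 4, Set.InjOn g {l | G.Adj b l ∧ G.degree l ≤ 1} ∧
      ∀ l, G.Adj b l → G.degree l ≤ 1 → SlotAdj (g l) ((e b : ℕ) + 1, 0) ∧
        (∀ i < m, g l ≠ (i + 1, 0)) ∧ (g l).1 ≤ m + 1 ∧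
        ((g l).2 = 3 → (g l).1 = (e b : ℕ) + 1 ∧ G.degree b = 5) := by
  classical
  set i : ℕ := (e b).val with hi
  have him : i < m := (e b).2
  let S : Finset (ℕ × Fin 4) :=
    {(i + 1, 1), (i + 1, 2), (i, 0), (i + 2, 0)} ∪
      if G.degree b = 5 then {(i + 1, 3)} else ∅
  have hS : G.degree b ≤ S.card := by
    by_cases h5 : G.degree b = 5
    · simp [S, h5, Finset.card_insert_of_notMem]
    · simp [S, h5, Finset.card_insert_of_notMem]
      omega
  let ψ : V → ℕ × Fin 4 := fun v => if h : 2 ≤ G.degree v then ((e ⟨v, h⟩ : ℕ) + 1, 0) else (0, 0)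
  let L := (G.neighborFinset b).filter (fun l => G.degree l ≤ 1)
  let H := (G.neighborFinset b).filter (fun l => ¬ G.degree l ≤ 1)
  have hLH : L.card + H.card = G.degree b := by
    rw [← G.card_neighborFinset_eq_degree]
    exact Finset.card_filter_add_card_filter_not _
  have hcard : L.card ≤ (S \ H.image ψ).card := by
    have h1 := Finset.le_card_sdiff (H.image ψ) S
    have h2 : (H.image ψ).card ≤ H.card := Finset.card_image_le
    omega
  obtain ⟨g, hg, hinj⟩ := L.finite_toSet.exists_injOn_of_encard_le
    (t := ((S \ H.image ψ : Finset _) : Set (ℕ × Fin 4))) (by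
      rw [Set.encard_coe_eq_coe_finsetCard, Set.encard_coe_eq_coe_finsetCard]
      exact_mod_cast hcard)
  refine ⟨g, ?_, fun l hbl hl => ?_⟩
  · intro x hx y hy hxy
    exact hinj (by simpa [L] using hx) (by simpa [L] using hy) hxy
  have hmem : g l ∈ S \ H.image ψ := by
    have := hg (a := l) (by simp [L, hbl, hl])
    simpa using this
  obtain ⟨hlS, hlB⟩ := Finset.mem_sdiff.1 hmem
  generalize g l = q at hlS hlB
  have hslot : q = (i + 1, 1) ∨ q = (i + 1, 2) ∨ q = (i, 0) ∨ q = (i + 2, 0) ∨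
      q = (i + 1, 3) ∧ G.degree b = 5 := by
    by_cases h5 : G.degree b = 5 <;> simp [S, h5] at hlS ⊢ <;> tauto
  have hadj : SlotAdj q (i + 1, 0) := by
    rcases hslot with rfl | rfl | rfl | rfl | ⟨rfl, -⟩ <;> simp [SlotAdj]
  refine ⟨hadj, ?_, ?_, ?_⟩
  · rintro j hj rfl
    apply hlB
    obtain ⟨⟨w, hw⟩, hwj⟩ := e.surjective ⟨j, hj⟩
    have hwj' : (e ⟨w, hw⟩ : ℕ) = j := by rw [hwj]
    have hw2 : 2 ≤ G.degree w := hw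
    refine Finset.mem_image.2 ⟨w, ?_, ?_⟩
    · have : (G.induce {v : V | 2 ≤ G.degree v}).Adj b ⟨w, hw⟩ := by
        rw [he, hwj', ← hi]
        simp [SlotAdj] at hadj
        omega
      have h2 : G.Adj b w := this
      simp only [H, Finset.mem_filter, SimpleGraph.mem_neighborFinset]
      exact ⟨h2, by omega⟩
    · simp only [ψ, dif_pos hw2]
      rw [← hwj']
  · rcases hslot with rfl | rfl | rfl | rfl | ⟨rfl, -⟩ <;> simp <;> omega
  · rcases hslot with rfl | rfl | rfl | rfl | ⟨rfl, hb5⟩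
    · simp
    · simp
    · simp
    · simp
    · exact fun _ => ⟨rfl, hb5⟩

theorem IsCaterpillar.exists_slots {V : Type*} [Fintype V] {G : SimpleGraph V}
    [DecidableRel G.Adj] (hcat : IsCaterpillar G) (h5 : ∀ v, G.degree v ≤ 5)
    (h55 : ∀ u v, G.Adj u v → ¬ (G.degree u = 5 ∧ G.degree v = 5))
    (h2 : ∃ v, 2 ≤ G.degree v) :
    ∃ (n : ℕ) (t : ℕ → Prop) (φ : V → ℕ × Fin 4), ¬ t 0 ∧ ¬ t n ∧
      (∀ i, ¬ (t i ∧ t (i + 1))) ∧ (∀ v, (φ v).1 ≤ n ∧ ((φ v).2 = 3 → t (φ v).1)) ∧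
      Function.Injective φ ∧ ∀ u v, u ≠ v → (G.Adj u v ↔ SlotAdj (φ u) (φ v)) := by
  classical
  obtain ⟨hT, m, e, he⟩ := hcat
  obtain ⟨c, hc⟩ := h2
  have hpar : ∀ l, G.degree l ≤ 1 → ∃ b : {v : V | 2 ≤ G.degree v}, G.Adj b l ∧
      ∀ x, G.Adj x l → x = b := by
    intro l hl
    have hlc : l ≠ c := by rintro rfl; omega
    have : Nontrivial V := ⟨l, c, hlc⟩
    have hpos := hT.connected.preconnected.degree_pos_of_nontrivial l
    obtain ⟨p, hp⟩ := (G.degree_pos_iff_exists_adj l).1 hpos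
    have hp2 : 2 ≤ G.degree p := by
      by_contra! hlt
      rcases hT.connected.eq_or_eq_of_degree_le_one hp hl (by omega) c with rfl | rfl <;> omega
    refine ⟨⟨p, hp2⟩, hp.symm, fun x hx => ?_⟩
    rw [← G.card_neighborFinset_eq_degree, Finset.card_le_one] at hl
    exact hl x (by simpa using hx.symm) p (by simpa using hp)
  choose g hginj hg using fun b : {v : V | 2 ≤ G.degree v} =>
    exists_injOn_leaf_slots e he b (h5 b)
  choose par hpar hparu using hpar
  let t : ℕ → Prop := fun j => ∃ w : {v : V | 2 ≤ G.degree v}, (e w : ℕ) + 1 = j ∧ G.degree w = 5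
  let φ : V → ℕ × Fin 4 := fun v =>
    if h : G.degree v ≤ 1 then g (par v h) v else ((e ⟨v, not_le.1 h⟩ : ℕ) + 1, 0)
  have hφl : ∀ v (h : G.degree v ≤ 1), φ v = g (par v h) v := fun v h => dif_pos h
  have hφh : ∀ v : {v : V | 2 ≤ G.degree v}, φ v = ((e v : ℕ) + 1, 0) := fun v =>
    dif_neg (not_le.2 v.2)
  have hgl : ∀ v (h : G.degree v ≤ 1), _ := fun v h => hg (par v h) v (hpar v h) h
  have key : ∀ v : V, (G.degree v ≤ 1) ∨ ∃ w : {v : V | 2 ≤ G.degree v}, (w : V) = v := fun v => by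
    rcases le_or_gt (G.degree v) 1 with h | h
    · exact Or.inl h
    · exact Or.inr ⟨⟨v, h⟩, rfl⟩
  have hlh : ∀ u (hu : G.degree u ≤ 1) (w : {v : V | 2 ≤ G.degree v}),
      φ u ≠ φ w ∧ (G.Adj u w ↔ SlotAdj (φ u) (φ w)) := by
    intro u hu w
    obtain ⟨h1, h2, -, -⟩ := hgl u hu
    rw [hφl u hu, hφh]
    refine ⟨h2 _ (e w).2, fun h => ?_, fun h => ?_⟩
    · have hw : w = par u hu := Subtype.ext (hparu u hu w h.symm)
      rw [hw]
      exact h1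
    · have h3 : e (par u hu) = e w :=
        Fin.ext (SlotAdj.eq_of_not_hub h2 (e _).2 (e w).2 h1 h)
      rw [← e.injective h3]
      exact (hpar u hu).symm
  have hhh : ∀ w w' : {v : V | 2 ≤ G.degree v}, G.Adj w w' ↔ SlotAdj (φ w) (φ w') := by
    intro w w'
    have h : G.Adj w w' ↔ _ := he w w'
    rw [h, hφh, hφh]
    simp [SlotAdj]
  refine ⟨m + 1, t, φ, ?_, ?_, ?_, ?_, ?_, ?_⟩
  · rintro ⟨w, hw, -⟩
    omega
  · rintro ⟨w, hw, -⟩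
    have := (e w).2
    omega
  · rintro i ⟨⟨w, hw, hw5⟩, ⟨w', hw', hw5'⟩⟩
    exact h55 w w' ((he w w').2 (by omega)) ⟨hw5, hw5'⟩
  · intro v
    rcases key v with h | ⟨w, rfl⟩
    · obtain ⟨-, -, h3, h4⟩ := hgl v h
      rw [hφl v h]
      exact ⟨h3, fun hk => ⟨par v h, (h4 hk).1.symm, (h4 hk).2⟩⟩
    · rw [hφh]
      have := (e w).2
      exact ⟨by simp only; omega, fun hk => by simp at hk⟩
  · intro u v huv
    rcases key u with hu | ⟨w, rfl⟩ <;> rcases key v with hv | ⟨w', rfl⟩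
    · have h1 := hgl u hu
      have h2 := hgl v hv
      rw [hφl u hu, hφl v hv] at huv
      have h3 : par u hu = par v hv := by
        apply e.injective
        refine Fin.ext (SlotAdj.eq_of_not_hub h1.2.1 (e _).2 (e _).2 h1.1 ?_)
        rw [huv]
        exact h2.1
      have h4 := hpar u hu
      rw [h3] at huv h4
      exact hginj (par v hv) ⟨h4, hu⟩ ⟨hpar v hv, hv⟩ huv
    · exact absurd huv (hlh u hu w').1
    · exact absurd huv.symm (hlh v hv w).1
    · rw [hφh, hφh, Prod.mk.injEq] at huv
      rw [e.injective (Fin.ext (by omega) : e w = e w')]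
  · intro u v _
    rcases key u with hu | ⟨w, rfl⟩ <;> rcases key v with hv | ⟨w', rfl⟩
    · refine iff_of_false (fun h => ?_) ?_
      · have h1 := hparu u hu v h.symm
        have h2 : 2 ≤ G.degree (par u hu : V) := (par u hu).2
        rw [← h1] at h2
        omega
      · rw [hφl u hu, hφl v hv]
        exact SlotAdj.not_adj_of_not_hub (hgl u hu).2.1 (hgl v hv).2.1 (e _).2 (e _).2
          (hgl u hu).1 (hgl v hv).1
    · exact (hlh u hu w').2
    · rw [G.adj_comm, SlotAdj.comm]
      exact (hlh v hv w).2
    · exact hhh w w'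

/-- A caterpillar admits a unit disk intersection representation iff every vertex has
degree at most 5 and no two adjacent vertices both have degree 5. -/
theorem caterpillar_UDR_iff
    {V : Type*} [Fintype V] (G : SimpleGraph V) [DecidableRel G.Adj]
    (hcat : IsCaterpillar G) :
    (∃ d : V → EuclideanSpace ℝ (Fin 2), IsUDR G d) ↔
      ((∀ v : V, G.degree v ≤ 5) ∧
        ∀ u v : V, G.Adj u v → ¬ (G.degree u = 5 ∧ G.degree v = 5)) := by
  constructor
  · rintro ⟨d, hd⟩
    have hd' : ∀ u v, u ≠ v → (G.Adj u v ↔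
        ‖Complex.orthonormalBasisOneI.repr.symm (d u) -
          Complex.orthonormalBasisOneI.repr.symm (d v)‖ ≤ 2) := fun u v huv => by
      rw [hd u v huv, ← dist_eq_norm, LinearIsometryEquiv.dist_map]
    exact ⟨degree_le_five hcat.1.isAcyclic hd',
      fun u v huv => not_degree_eq_five_of_adj hcat.1.isAcyclic hd' huv⟩
  · rintro ⟨h5, h55⟩
    by_cases h2 : ∃ v, 2 ≤ G.degree v
    · obtain ⟨n, t, φ, h0, hn, ht, hφ, hinj, hadj⟩ := hcat.exists_slots h5 h55 h2
      obtain ⟨s, P, hP⟩ := exists_isStandardPlacement n t h0 hn ht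
      refine ⟨fun v => Complex.orthonormalBasisOneI.repr (P (φ v).1 (φ v).2), fun u v huv => ?_⟩
      rw [LinearIsometryEquiv.dist_map, dist_eq_norm, hadj u v huv,
        hP.chain.norm_le_two_iff (hinj.ne huv) (hφ u).1 (hφ v).1 (hφ u).2 (hφ v).2]
    · push Not at h2
      refine ⟨fun _ => 0, fun u v huv => iff_of_true ?_ (by simp)⟩
      have : Nontrivial V := ⟨u, v, huv⟩
      have hpos := hcat.1.connected.preconnected.degree_pos_of_nontrivial u
      obtain ⟨p, hp⟩ := (G.degree_pos_iff_exists_adj u).1 hpos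
      rcases hcat.1.connected.eq_or_eq_of_degree_le_one hp (Nat.le_of_lt_succ (h2 u))
        (Nat.le_of_lt_succ (h2 p)) v with rfl | rfl
      · exact absurd rfl huv
      · exact hp
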